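/- arXiv:2605.23061 — 4 statements merged into one kernel-verified Lean document; each statement's English description precedes it below -/
import Mathlib

section
/- Under spectral L_S-smoothness and the spectral diameter assumption, in the noiseless case (G_t = ∇f(Y_t) for all t, i.e. σ = 0), for any fixed β ∈ [0,1), choosing μ = 0 and η = √(2A_T/(L_S T)) with A_T := Δ + 2L_S D_S²(log(eT) + π²/6), Schedule-Free Spectral Descent with momentum satisfies for every T ≥ 1: (1/T)·Σ_{t=0}^{T−1} ‖∇f(Y_t)‖_* ≤ (1/(1−β))·[√(2 L_S A_T / T) + 2 L_S D_S log(eT)/T]; in particular the left-hand side is O(√(log T / T)). -/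
open Matrix MeasureTheory Finset Filter

noncomputable section

/-- Real `m × n` matrices. -/
abbrev Mat (m n : ℕ) := Matrix (Fin m) (Fin n) ℝ

/-- Frobenius (trace) inner product `⟨A, B⟩_F = tr(Aᵀ B)`. -/
def frobInner {m n : ℕ} (A B : Mat m n) : ℝ := ∑ i, ∑ j, A i j * B i j

/-- Frobenius norm. -/
def frobNorm {m n : ℕ} (A : Mat m n) : ℝ := Real.sqrt (∑ i, ∑ j, (A i j) ^ 2)

/-- Spectral norm (`ℓ₂ → ℓ₂` operator norm, i.e. largest singular value). -/
def specNorm {m n : ℕ} (A : Mat m n) : ℝ :=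
  sSup {c : ℝ | ∃ u : Fin n → ℝ, (∑ j, (u j) ^ 2) ≤ 1 ∧
    c = Real.sqrt (∑ i, (A.mulVec u i) ^ 2)}

/-- Nuclear norm (sum of singular values), via duality with the spectral norm. -/
def nucNorm {m n : ℕ} (A : Mat m n) : ℝ :=
  sSup {c : ℝ | ∃ Q : Mat m n, specNorm Q ≤ 1 ∧ c = frobInner A Q}

/-- `P` is the polar factor `U Vᵀ` of a compact SVD `M = U Σ Vᵀ`
(`U`, `V` with orthonormal columns, `Σ` positive diagonal). -/
def IsPolarFactor {m n : ℕ} (M P : Mat m n) : Prop :=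
  ∃ (k : ℕ) (U : Matrix (Fin m) (Fin k) ℝ) (V : Matrix (Fin n) (Fin k) ℝ)
    (s : Fin k → ℝ),
    Uᵀ * U = 1 ∧ Vᵀ * V = 1 ∧ (∀ i, 0 < s i) ∧
    M = U * Matrix.diagonal s * Vᵀ ∧ P = U * Vᵀ

/-- `gradf` is the gradient of `f` with respect to the Frobenius inner product:
along every line `s ↦ A + s • H`, `f` has derivative `⟨gradf A, H⟩_F` at `s = 0`. -/
def IsGradient {m n : ℕ} (f : Mat m n → ℝ) (gradf : Mat m n → Mat m n) : Prop :=
  ∀ A H : Mat m n, HasDerivAt (fun s : ℝ => f (A + s • H)) (frobInner (gradf A) H) 0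

section SpectralNorms

open scoped Matrix.Norms.L2Operator

theorem specNorm_eq_l2_opNorm {m n : ℕ} (A : Mat m n) : specNorm A = ‖A‖ := by
  rw [Matrix.l2_opNorm_def, ← ContinuousLinearMap.sSup_unitClosedBall_eq_norm]
  unfold specNorm
  congr 1
  ext c
  simp only [Set.mem_ofPred_eq, Set.mem_image, Metric.mem_closedBall, dist_zero_right]
  constructor
  · rintro ⟨u, hu, rfl⟩
    refine ⟨WithLp.toLp 2 u, ?_, ?_⟩
    · rw [EuclideanSpace.norm_eq, Real.sqrt_le_one]
      simpa using hu
    · simp [EuclideanSpace.norm_eq, Matrix.toLpLin_apply]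
  · rintro ⟨u, hu, rfl⟩
    refine ⟨WithLp.ofLp u, ?_, ?_⟩
    · rw [EuclideanSpace.norm_eq, Real.sqrt_le_one] at hu
      simpa using hu
    · simp [EuclideanSpace.norm_eq, Matrix.toLpLin_apply]

theorem specNorm_nonneg {m n : ℕ} (A : Mat m n) : 0 ≤ specNorm A := by
  rw [specNorm_eq_l2_opNorm]
  exact norm_nonneg A

theorem specNorm_add_le {m n : ℕ} (A B : Mat m n) :
    specNorm (A + B) ≤ specNorm A + specNorm B := by
  simpa only [specNorm_eq_l2_opNorm] using norm_add_le A B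

theorem specNorm_sub_le {m n : ℕ} (A B : Mat m n) :
    specNorm (A - B) ≤ specNorm A + specNorm B := by
  simpa only [specNorm_eq_l2_opNorm] using norm_sub_le A B

theorem specNorm_sub_comm {m n : ℕ} (A B : Mat m n) :
    specNorm (A - B) = specNorm (B - A) := by
  simpa only [specNorm_eq_l2_opNorm] using norm_sub_rev A B

theorem specNorm_smul {m n : ℕ} (c : ℝ) (A : Mat m n) :
    specNorm (c • A) = |c| * specNorm A := by
  simpa only [specNorm_eq_l2_opNorm, Real.norm_eq_abs] using norm_smul c A

theorem abs_apply_le_l2_opNorm {m n : ℕ} (A : Mat m n) (i : Fin m) (j : Fin n) :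
    |A i j| ≤ ‖A‖ := by
  have h := Matrix.l2_opNorm_mulVec A (EuclideanSpace.single j (1 : ℝ))
  have h2 := PiLp.norm_apply_le
    (WithLp.toLp 2 (A *ᵥ (EuclideanSpace.single j (1 : ℝ)).ofLp)) i
  simp only [PiLp.ofLp_single, Matrix.mulVec_single_one, Real.norm_eq_abs,
    Matrix.col_apply] at h2
  refine h2.trans (le_of_le_of_eq (h.trans_eq' ?_) ?_)
  · simp
  · simp

theorem l2_opNorm_le_one_of_transpose_mul_self {m k : ℕ} {U : Mat m k}
    (hU : Uᵀ * U = 1) : ‖U‖ ≤ 1 := by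
  have h := Matrix.l2_opNorm_conjTranspose_mul_self U
  rw [Matrix.conjTranspose_eq_transpose_of_trivial, hU] at h
  have h1 : ‖(1 : Mat k k)‖ ≤ 1 := by
    rw [← Matrix.diagonal_one, Matrix.l2_opNorm_diagonal]
    exact (pi_norm_le_iff_of_nonneg zero_le_one).2 fun i => by simp
  nlinarith [norm_nonneg U]

theorem frobInner_eq_trace {m n : ℕ} (A B : Mat m n) :
    frobInner A B = (Aᵀ * B).trace := by
  simp only [frobInner, Matrix.trace, Matrix.diag, Matrix.mul_apply, Matrix.transpose_apply]
  exact Finset.sum_comm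

theorem frobInner_add_right {m n : ℕ} (A B C : Mat m n) :
    frobInner A (B + C) = frobInner A B + frobInner A C := by
  simp [frobInner_eq_trace, Matrix.mul_add]

theorem frobInner_sub_left {m n : ℕ} (A B C : Mat m n) :
    frobInner (A - B) C = frobInner A C - frobInner B C := by
  simp [frobInner_eq_trace, Matrix.sub_mul]

theorem frobInner_neg_left {m n : ℕ} (A B : Mat m n) :
    frobInner (-A) B = -frobInner A B := by
  simp [frobInner_eq_trace]

theorem frobInner_smul_right {m n : ℕ} (c : ℝ) (A B : Mat m n) :
    frobInner A (c • B) = c * frobInner A B := by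
  simp [frobInner_eq_trace]

theorem bddAbove_frobInner_unitBall {m n : ℕ} (A : Mat m n) :
    BddAbove {c : ℝ | ∃ Q : Mat m n, specNorm Q ≤ 1 ∧ c = frobInner A Q} := by
  refine ⟨∑ i, ∑ j, |A i j|, ?_⟩
  rintro c ⟨Q, hQ, rfl⟩
  refine Finset.sum_le_sum fun i _ => Finset.sum_le_sum fun j _ => ?_
  rw [specNorm_eq_l2_opNorm] at hQ
  calc A i j * Q i j ≤ |A i j * Q i j| := le_abs_self _
    _ = |A i j| * |Q i j| := abs_mul _ _
    _ ≤ |A i j| * 1 := by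
      gcongr
      exact (abs_apply_le_l2_opNorm Q i j).trans hQ
    _ = |A i j| := mul_one _

theorem frobInner_le_nucNorm_mul_specNorm {m n : ℕ} (A B : Mat m n) :
    frobInner A B ≤ nucNorm A * specNorm B := by
  rcases (specNorm_nonneg B).eq_or_lt with h | h
  · have hB : B = 0 := by
      rw [specNorm_eq_l2_opNorm] at h
      exact norm_eq_zero.1 h.symm
    rw [← h, hB]
    simp [frobInner]
  · have hle : frobInner A ((specNorm B)⁻¹ • B) ≤ nucNorm A := by
      refine le_csSup (bddAbove_frobInner_unitBall A) ⟨_, ?_, rfl⟩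
      rw [specNorm_smul, abs_of_pos (inv_pos.2 h), inv_mul_cancel₀ h.ne']
    rw [frobInner_smul_right, inv_mul_le_iff₀ h] at hle
    linarith

theorem IsPolarFactor.specNorm_le_one {m n : ℕ} {M P : Mat m n}
    (h : IsPolarFactor M P) : specNorm P ≤ 1 := by
  obtain ⟨k, U, V, s, hU, hV, -, -, rfl⟩ := h
  rw [specNorm_eq_l2_opNorm]
  refine (Matrix.l2_opNorm_mul _ _).trans ?_
  rw [← Matrix.conjTranspose_eq_transpose_of_trivial, Matrix.l2_opNorm_conjTranspose]
  exact mul_le_one₀ (l2_opNorm_le_one_of_transpose_mul_self hU) (norm_nonneg _)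
    (l2_opNorm_le_one_of_transpose_mul_self hV)

theorem IsPolarFactor.nucNorm_le_frobInner {m n : ℕ} {M P : Mat m n}
    (h : IsPolarFactor M P) : nucNorm M ≤ frobInner M P := by
  obtain ⟨k, U, V, s, hU, hV, hs, rfl, rfl⟩ := h
  have key : ∀ Q : Mat m n, frobInner (U * Matrix.diagonal s * Vᵀ) Q =
      ∑ i, s i * (Uᵀ * Q * V) i i := by
    intro Q
    rw [frobInner_eq_trace, Matrix.transpose_mul, Matrix.transpose_transpose,
      Matrix.transpose_mul, Matrix.diagonal_transpose, Matrix.mul_assoc, Matrix.trace_mul_comm]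
    simp only [Matrix.mul_assoc, Matrix.trace, Matrix.diag, Matrix.diagonal_mul]
  have hP : frobInner (U * Matrix.diagonal s * Vᵀ) (U * Vᵀ) = ∑ i, s i := by
    rw [key, ← Matrix.mul_assoc, hU, Matrix.one_mul, hV]
    simp
  rw [hP]
  refine csSup_le ⟨_, 0, by simp [specNorm_eq_l2_opNorm], rfl⟩ ?_
  rintro c ⟨Q, hQ, rfl⟩
  rw [key]
  rw [specNorm_eq_l2_opNorm] at hQ
  refine Finset.sum_le_sum fun i _ => mul_le_of_le_one_right (hs i).le ?_
  calc (Uᵀ * Q * V) i i ≤ |(Uᵀ * Q * V) i i| := le_abs_self _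
    _ ≤ ‖Uᵀ * Q * V‖ := abs_apply_le_l2_opNorm _ i i
    _ ≤ ‖Uᵀ * Q‖ * ‖V‖ := Matrix.l2_opNorm_mul _ _
    _ ≤ 1 := by
      refine mul_le_one₀ ((Matrix.l2_opNorm_mul _ _).trans ?_) (norm_nonneg _)
        (l2_opNorm_le_one_of_transpose_mul_self hV)
      rw [← Matrix.conjTranspose_eq_transpose_of_trivial, Matrix.l2_opNorm_conjTranspose]
      exact mul_le_one₀ (l2_opNorm_le_one_of_transpose_mul_self hU) (norm_nonneg _) hQ

end SpectralNorms

theorem IsGradient.neg {m n : ℕ} {f : Mat m n → ℝ} {gradf : Mat m n → Mat m n}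
    (h : IsGradient f gradf) : IsGradient (fun A => -f A) (fun A => -gradf A) := by
  intro A H
  rw [frobInner_neg_left]
  exact (h A H).neg

theorem IsGradient.hasDerivAt_line {m n : ℕ} {f : Mat m n → ℝ}
    {gradf : Mat m n → Mat m n} (h : IsGradient f gradf) (A H : Mat m n) (s : ℝ) :
    HasDerivAt (fun r : ℝ => f (A + r • H)) (frobInner (gradf (A + s • H)) H) s := by
  have h0 := h (A + s • H) H
  rw [← sub_self s] at h0
  have h1 := h0.comp_sub_const s s
  refine h1.congr_of_eventuallyEq (Filter.Eventually.of_forall fun r => ?_)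
  simp only [add_assoc, ← add_smul, add_sub_cancel]

/-- Descent lemma for a gradient that is Lipschitz from the spectral to the nuclear norm. -/
theorem IsGradient.le_add_frobInner_add_sq {m n : ℕ} {f : Mat m n → ℝ}
    {gradf : Mat m n → Mat m n} (hgrad : IsGradient f gradf) {L : ℝ}
    (hsmooth : ∀ A B : Mat m n, nucNorm (gradf A - gradf B) ≤ L * specNorm (A - B))
    (A H : Mat m n) :
    f (A + H) ≤ f A + frobInner (gradf A) H + L / 2 * specNorm H ^ 2 := by
  set ψ : ℝ → ℝ := fun s =>
    f (A + s • H) - s * frobInner (gradf A) H - L / 2 * specNorm H ^ 2 * s ^ 2 with hψ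
  have hderiv : ∀ s, HasDerivAt ψ (frobInner (gradf (A + s • H)) H - frobInner (gradf A) H
      - L * specNorm H ^ 2 * s) s := by
    intro s
    have h := ((hgrad.hasDerivAt_line A H s).sub
      ((hasDerivAt_id s).mul_const (frobInner (gradf A) H))).sub
      (((hasDerivAt_id s).pow 2).const_mul (L / 2 * specNorm H ^ 2))
    refine h.congr_deriv ?_
    simp
    ring
  have hanti : AntitoneOn ψ (Set.Icc 0 1) := by
    refine antitoneOn_of_deriv_nonpos (convex_Icc 0 1)
      (fun s _ => (hderiv s).continuousAt.continuousWithinAt)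
      (fun s _ => (hderiv s).differentiableAt.differentiableWithinAt) fun s hs => ?_
    rw [interior_Icc] at hs
    rw [(hderiv s).deriv, ← frobInner_sub_left]
    have h1 := frobInner_le_nucNorm_mul_specNorm (gradf (A + s • H) - gradf A) H
    have h2 := hsmooth (A + s • H) A
    rw [add_sub_cancel_left, specNorm_smul, abs_of_pos hs.1] at h2
    have h3 := mul_le_mul_of_nonneg_right h2 (specNorm_nonneg H)
    linarith
  have h := hanti (Set.left_mem_Icc.2 zero_le_one) (Set.right_mem_Icc.2 zero_le_one) zero_le_one
  simp only [hψ, one_smul, zero_smul, add_zero] at h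
  linarith

/-- Quadratic lower bound around a critical point of a spectrally smooth function. -/
theorem IsGradient.le_add_sq_of_critical {m n : ℕ} {f : Mat m n → ℝ}
    {gradf : Mat m n → Mat m n} (hgrad : IsGradient f gradf) {L : ℝ}
    (hsmooth : ∀ A B : Mat m n, nucNorm (gradf A - gradf B) ≤ L * specNorm (A - B))
    {W : Mat m n} (hW : gradf W = 0) (A : Mat m n) :
    f W ≤ f A + L / 2 * specNorm (A - W) ^ 2 := by
  have h := hgrad.neg.le_add_frobInner_add_sq (L := L) (fun A B => by
    rw [neg_sub_neg, specNorm_sub_comm]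
    exact hsmooth B A) W (A - W)
  have h0 : frobInner (-gradf W) (A - W) = 0 := by
    rw [hW]
    simp [frobInner]
  rw [add_sub_cancel, h0] at h
  linarith

theorem sum_one_div_succ_le_log {T : ℕ} (hT : 1 ≤ T) :
    ∑ t ∈ Finset.range T, 1 / ((t : ℝ) + 1) ≤ Real.log (Real.exp 1 * T) := by
  have hT' : (T : ℝ) ≠ 0 := by positivity
  rw [Real.log_mul (Real.exp_ne_zero 1) hT', Real.log_exp]
  refine le_of_eq_of_le ?_ (harmonic_le_one_add_log T)
  simp [harmonic]

theorem sum_one_div_succ_sq_le (T : ℕ) :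
    ∑ t ∈ Finset.range T, 1 / ((t : ℝ) + 1) ^ 2 ≤ Real.pi ^ 2 / 6 := by
  have h := hasSum_zeta_two
  have h1 := sum_le_hasSum (Finset.range (T + 1)) (fun i _ => by positivity) h
  rw [Finset.sum_range_succ'] at h1
  simpa using h1

theorem specNorm_averaged_le {m n : ℕ} {X Z : ℕ → Mat m n} {R : ℝ} (h0 : X 0 = Z 0)
    (hX : ∀ t : ℕ, X (t + 1) =
      ((t : ℝ) / ((t : ℝ) + 1)) • X t + (1 / ((t : ℝ) + 1)) • Z (t + 1))
    (hZ : ∀ t, specNorm (Z t) ≤ R) (t : ℕ) : specNorm (X t) ≤ R := by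
  induction t with
  | zero => exact h0 ▸ hZ 0
  | succ t ih =>
    rw [hX]
    refine (specNorm_add_le _ _).trans ?_
    rw [specNorm_smul, specNorm_smul, abs_of_nonneg (by positivity), abs_of_nonneg (by positivity)]
    calc (t : ℝ) / (t + 1) * specNorm (X t) + 1 / (t + 1) * specNorm (Z (t + 1))
        ≤ (t : ℝ) / (t + 1) * R + 1 / (t + 1) * R := by
          gcongr
          exact hZ _
      _ = R := by
          field_simp

/-- One-step decrease of the objective along the schedule-free iterates. -/
theorem scheduleFree_step {m n : ℕ} {f : Mat m n → ℝ} {gradf : Mat m n → Mat m n}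
    (hgrad : IsGradient f gradf) {β L D η : ℝ} (hβ0 : 0 ≤ β) (hβ1 : β < 1) (hL : 0 < L)
    (hη : 0 ≤ η)
    (hsmooth : ∀ A B : Mat m n, nucNorm (gradf A - gradf B) ≤ L * specNorm (A - B))
    {X Z P Y' : Mat m n} (t : ℕ) (hP : IsPolarFactor (gradf (β • X + (1 - β) • Z)) P)
    (hXD : specNorm X ≤ D / 2) (hZD : specNorm (Z - η • P) ≤ D / 2)
    (hG : nucNorm (gradf (β • X + (1 - β) • Z)) ≤ L * D)
    (hY' : Y' = β • (((t : ℝ) / (t + 1)) • X + (1 / ((t : ℝ) + 1)) • (Z - η • P))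
      + (1 - β) • (Z - η • P)) :
    (1 - β) * η * nucNorm (gradf (β • X + (1 - β) • Z)) ≤
      f (β • X + (1 - β) • Z) - f Y' + β * L * D ^ 2 * (1 / ((t : ℝ) + 1))
        + L / 2 * (β * D * (1 / ((t : ℝ) + 1)) + (1 - β) * η) ^ 2 := by
  set Y := β • X + (1 - β) • Z with hY
  set a : ℝ := 1 / ((t : ℝ) + 1) with ha
  have ha0 : 0 ≤ a := by positivity
  have hta : (t : ℝ) / (t + 1) = 1 - a := by
    rw [ha]
    field_simp
    ring
  have hstep : Y' = Y + ((β * a) • ((Z - η • P) - X) + (-((1 - β) * η)) • P) := by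
    rw [hY', hta, hY]
    module
  have hβ : 0 ≤ 1 - β := by linarith
  have hdiff : specNorm ((Z - η • P) - X) ≤ D := by
    linarith [specNorm_sub_le (Z - η • P) X]
  have hD : 0 ≤ D := (specNorm_nonneg _).trans hdiff
  have hH : specNorm ((β * a) • ((Z - η • P) - X) + (-((1 - β) * η)) • P) ≤
      β * D * a + (1 - β) * η := by
    refine (specNorm_add_le _ _).trans ?_
    rw [specNorm_smul, specNorm_smul, abs_neg, abs_of_nonneg (by positivity),
      abs_of_nonneg (by positivity)]
    have h1 := mul_le_mul_of_nonneg_left hdiff (mul_nonneg hβ0 ha0)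
    have h2 := mul_le_mul_of_nonneg_left hP.specNorm_le_one (mul_nonneg hβ hη)
    linarith
  have hdesc := hgrad.le_add_frobInner_add_sq hsmooth Y
    ((β * a) • ((Z - η • P) - X) + (-((1 - β) * η)) • P)
  rw [← hstep, frobInner_add_right, frobInner_smul_right, frobInner_smul_right] at hdesc
  have hsq := mul_le_mul_of_nonneg_left (pow_le_pow_left₀ (specNorm_nonneg _) hH 2)
    (by positivity : 0 ≤ L / 2)
  have hcross : frobInner (gradf Y) ((Z - η • P) - X) ≤ L * D * D :=
    (frobInner_le_nucNorm_mul_specNorm _ _).trans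
      (mul_le_mul hG hdiff (specNorm_nonneg _) (by positivity))
  have h3 := mul_le_mul_of_nonneg_left hcross (mul_nonneg hβ0 ha0)
  have h4 := mul_le_mul_of_nonneg_left hP.nucNorm_le_frobInner (mul_nonneg hβ hη)
  nlinarith


/-- **Noiseless tuned rate under spectral smoothness.** With `μ = 0` and
`η = √(2A_T/(L_S T))`, `A_T = Δ + 2L_S D_S²(log(eT) + π²/6)`, for every `T ≥ 1`:
`(1/T)·Σ_{t<T} ‖∇f(Y_t)‖_* ≤ (1/(1−β))·[√(2L_S A_T/T) + 2L_S D_S log(eT)/T]`. -/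
theorem sf_spectral_noiseless_tuned_rate {m n : ℕ}
    (f : Mat m n → ℝ) (gradf : Mat m n → Mat m n) (hgrad : IsGradient f gradf)
    (β LS DS : ℝ) (hβ0 : 0 ≤ β) (hβ1 : β < 1) (hLS : 0 < LS)
    (hsmooth : ∀ A B : Mat m n, nucNorm (gradf A - gradf B) ≤ LS * specNorm (A - B))
    (Wstar : Mat m n) (hWgrad : gradf Wstar = 0) (hWdiam : specNorm Wstar ≤ DS / 2) :
    ∀ T : ℕ, 1 ≤ T →
    ∀ Y Z X P : ℕ → Mat m n,
      (∀ t, Y t = β • X t + (1 - β) • Z t) →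
      (∀ t, IsPolarFactor (gradf (Y t)) (P t)) →
      (∀ t, Z (t + 1) = Z t -
        Real.sqrt (2 * (f (Y 0) - f Wstar +
            2 * LS * DS ^ 2 * (Real.log (Real.exp 1 * T) + Real.pi ^ 2 / 6)) /
          (LS * T)) • P t) →
      X 0 = Z 0 →
      (∀ t : ℕ, X (t + 1) =
        ((t : ℝ) / ((t : ℝ) + 1)) • X t + (1 / ((t : ℝ) + 1)) • Z (t + 1)) →
      (∀ t, specNorm (Z t) ≤ DS / 2) →
      (1 / (T : ℝ)) * ∑ t ∈ Finset.range T, nucNorm (gradf (Y t)) ≤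
        (1 / (1 - β)) *
          (Real.sqrt (2 * LS * (f (Y 0) - f Wstar +
              2 * LS * DS ^ 2 * (Real.log (Real.exp 1 * T) + Real.pi ^ 2 / 6)) / T)
            + 2 * LS * DS * Real.log (Real.exp 1 * T) / T) := by
  intro T hT Y Z X P hY hP hZ hX0 hX hZD
  set h := Real.log (Real.exp 1 * T) with hh
  set q := Real.pi ^ 2 / 6 with hq
  set A := f (Y 0) - f Wstar + 2 * LS * DS ^ 2 * (h + q) with hA
  set η := Real.sqrt (2 * A / (LS * T)) with hη
  set S := ∑ t ∈ Finset.range T, nucNorm (gradf (Y t)) with hS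
  have hTpos : (0 : ℝ) < T := by exact_mod_cast hT
  have hβ : 0 < 1 - β := by linarith
  have hη0 : 0 ≤ η := Real.sqrt_nonneg _
  have hDS : 0 ≤ DS := by linarith [specNorm_nonneg Wstar]
  have hq0 : 0 ≤ q := by positivity
  have hh1 : 1 ≤ h := by
    rw [hh, Real.log_mul (Real.exp_ne_zero 1) hTpos.ne', Real.log_exp]
    linarith [Real.log_natCast_nonneg T]
  have hXD := specNorm_averaged_le hX0 hX hZD
  have hYD : ∀ t, specNorm (Y t - Wstar) ≤ DS := by
    intro t
    have h1 := specNorm_sub_le (Y t) Wstar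
    have h2 := specNorm_add_le (β • X t) ((1 - β) • Z t)
    rw [← hY, specNorm_smul, specNorm_smul, abs_of_nonneg hβ0, abs_of_pos hβ] at h2
    have h3 := mul_le_mul_of_nonneg_left (hXD t) hβ0
    have h4 := mul_le_mul_of_nonneg_left (hZD t) hβ.le
    linarith
  have hG : ∀ t, nucNorm (gradf (Y t)) ≤ LS * DS := by
    intro t
    have h1 := hsmooth (Y t) Wstar
    rw [hWgrad, sub_zero] at h1
    exact h1.trans (mul_le_mul_of_nonneg_left (hYD t) hLS.le)
  have hlow : ∀ t, f Wstar ≤ f (Y t) + LS / 2 * DS ^ 2 := by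
    intro t
    have h1 := hgrad.le_add_sq_of_critical hsmooth hWgrad (Y t)
    have h2 := mul_le_mul_of_nonneg_left
      (pow_le_pow_left₀ (specNorm_nonneg _) (hYD t) 2) (by positivity : 0 ≤ LS / 2)
    linarith
  have hstep : ∀ t, (1 - β) * η * nucNorm (gradf (Y t)) ≤
      f (Y t) - f (Y (t + 1)) + β * LS * DS ^ 2 * (1 / ((t : ℝ) + 1))
        + LS / 2 * (β * DS * (1 / ((t : ℝ) + 1)) + (1 - β) * η) ^ 2 := by
    intro t
    have hPt := hP t
    have hGt := hG t
    have hZt := hZD (t + 1)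
    rw [hZ t] at hZt
    rw [hY t] at hPt hGt ⊢
    refine scheduleFree_step hgrad hβ0 hβ1 hLS hη0 hsmooth t hPt (hXD t) hZt hGt ?_
    rw [hY (t + 1), hX t, hZ t]
  have hsum : (1 - β) * η * S ≤ f (Y 0) - f (Y T) + β * LS * DS ^ 2 * h
      + LS / 2 * (β ^ 2 * DS ^ 2 * q + 2 * β * DS * (1 - β) * η * h
        + T * ((1 - β) * η) ^ 2) := by
    have h1 := Finset.sum_le_sum fun t (_ : t ∈ Finset.range T) => hstep t
    have hexp : ∀ t : ℕ, f (Y t) - f (Y (t + 1)) + β * LS * DS ^ 2 * (1 / ((t : ℝ) + 1))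
        + LS / 2 * (β * DS * (1 / ((t : ℝ) + 1)) + (1 - β) * η) ^ 2 =
        (f (Y t) - f (Y (t + 1)))
        + (β * LS * DS ^ 2 + LS * (β * DS * (1 - β) * η)) * (1 / ((t : ℝ) + 1))
        + (LS / 2 * (β ^ 2 * DS ^ 2)) * (1 / ((t : ℝ) + 1) ^ 2)
        + LS / 2 * ((1 - β) * η) ^ 2 := by
      intro t
      rw [← _root_.one_div_pow]
      ring
    simp only [hexp] at h1
    rw [← Finset.mul_sum, Finset.sum_add_distrib, Finset.sum_add_distrib,
      Finset.sum_add_distrib, Finset.sum_range_sub', ← Finset.mul_sum, ← Finset.mul_sum,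
      Finset.sum_const, Finset.card_range, nsmul_eq_mul, ← hS] at h1
    have h2 := mul_le_mul_of_nonneg_left (sum_one_div_succ_le_log hT)
      (by positivity : 0 ≤ β * LS * DS ^ 2 + LS * (β * DS * (1 - β) * η))
    have h3 := mul_le_mul_of_nonneg_left (sum_one_div_succ_sq_le T)
      (by positivity : 0 ≤ LS / 2 * (β ^ 2 * DS ^ 2))
    rw [← hh] at h2
    rw [← hq] at h3
    linarith
  have hsqrt : Real.sqrt (2 * LS * A / T) = LS * η := by
    rw [hη, show 2 * LS * A / T = LS ^ 2 * (2 * A / (LS * T)) by field_simp,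
      Real.sqrt_mul (sq_nonneg LS), Real.sqrt_sq hLS.le]
  have hgoal : (1 - β) * S ≤ T * (LS * η) + 2 * LS * DS * h := by
    rcases hDS.eq_or_lt with hD | hD
    · have hS0 : S ≤ 0 := Finset.sum_nonpos fun t _ => by simpa [← hD] using hG t
      have h1 : 0 ≤ T * (LS * η) := by positivity
      rw [← hD]
      nlinarith
    · have hD2 : 0 < LS * DS ^ 2 := by positivity
      have hA0 : 0 < A := by nlinarith [hlow 0, mul_nonneg hD2.le hq0]
      have hηpos : 0 < η := Real.sqrt_pos.2 (by positivity)
      have hηsq : LS * T * η ^ 2 = 2 * A := by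
        rw [hη, Real.sq_sqrt (by positivity)]
        field_simp
      have hb2 : β ^ 2 ≤ 1 := by nlinarith
      have hc2 : (1 - β) ^ 2 ≤ 1 := by nlinarith
      have e1 : β * (LS * DS ^ 2 * h) ≤ 1 * (LS * DS ^ 2 * h) := by gcongr
      have e2 : β ^ 2 * (LS * DS ^ 2 * q) ≤ 1 * (LS * DS ^ 2 * q) := by gcongr
      have e3 : (β * (1 - β)) * (LS * DS * η * h) ≤ 1 * (LS * DS * η * h) := by
        gcongr
        nlinarith
      have e4 : (1 - β) ^ 2 * (LS * T * η ^ 2) ≤ 1 * (LS * T * η ^ 2) := by gcongr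
      have e5 : LS * DS ^ 2 ≤ LS * DS ^ 2 * h := le_mul_of_one_le_right hD2.le hh1
      have e6 : 0 ≤ LS * DS ^ 2 * q := by positivity
      have e7 : 0 ≤ LS * DS * η * h := by positivity
      have hfin : η * ((1 - β) * S) ≤ η * (T * (LS * η) + 2 * LS * DS * h) := by
        linarith [hlow T]
      exact le_of_mul_le_mul_left hfin hηpos
  rw [hsqrt, one_div_mul_eq_div, one_div_mul_eq_div, div_le_div_iff₀ hTpos hβ]
  have hexpand : (LS * η + 2 * LS * DS * h / T) * T = T * (LS * η) + 2 * LS * DS * h := by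
    field_simp
  rw [hexpand]
  linarith
end
end

section
/- Consider the weight-decayed update Z_{t+1} = Z_t − ηλZ_t − η̂_t P̂_t with η̂_t = 0.2η√(mn)/‖P̂_t‖_F, and define the RMS norm ρ_t := ‖Z_t‖_F/√(mn) and the alignment α_t := ⟨P̂_t, Z_t⟩_F/(‖P̂_t‖_F‖Z_t‖_F) ∈ [−1,1] (for Z_t ≠ 0). Then the exact squared-norm recursion ρ_{t+1}² = (1 − ηλ)² ρ_t² − 0.4η(1 − ηλ)α_t ρ_t + 0.04η² holds. Moreover, if ρ ≥ 0 solves the steady-state quadratic λρ² + 0.2αρ − 0.02η = 0 (obtained from the fixed-point condition ρ_{t+1} = ρ_t = ρ under the first-order approximations 1 − (1−ηλ)² ≈ 2ηλ and 1 − ηλ ≈ 1 valid for ηλ ≪ 1), then λρ = 0.1·(−α + √(α² + 2ηλ)). -/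
open Matrix MeasureTheory Finset Filter

noncomputable section

theorem frobNorm_sq {m n : ℕ} (A : Mat m n) : frobNorm A ^ 2 = ∑ i, ∑ j, (A i j) ^ 2 :=
  Real.sq_sqrt (Finset.sum_nonneg fun _ _ => Finset.sum_nonneg fun _ _ => sq_nonneg _)

theorem frobNorm_pos {m n : ℕ} {A : Mat m n} (hA : A ≠ 0) : 0 < frobNorm A := by
  obtain ⟨i, j, hij⟩ : ∃ i j, A i j ≠ 0 := by
    by_contra! h
    exact hA (Matrix.ext h)
  refine Real.sqrt_pos.mpr (Finset.sum_pos' (fun _ _ => Finset.sum_nonneg fun _ _ => sq_nonneg _)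
    ⟨i, Finset.mem_univ i, Finset.sum_pos' (fun _ _ => sq_nonneg _)
      ⟨j, Finset.mem_univ j, by positivity⟩⟩)

theorem frobNorm_smul_sub_smul_sq {m n : ℕ} (a b : ℝ) (A B : Mat m n) :
    frobNorm (a • A - b • B) ^ 2 =
      a ^ 2 * frobNorm A ^ 2 - 2 * a * b * frobInner B A + b ^ 2 * frobNorm B ^ 2 := by
  simp only [frobNorm_sq, frobInner, Finset.mul_sum, ← Finset.sum_sub_distrib,
    ← Finset.sum_add_distrib]
  refine Finset.sum_congr rfl fun i _ => Finset.sum_congr rfl fun j _ => ?_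
  simp only [Matrix.sub_apply, Matrix.smul_apply, smul_eq_mul]
  ring

/-- **Quasi steady-state of `Z` under weight decay.**
With `ρ_t := ‖Z_t‖_F/√(mn)` and alignment
`α_t := ⟨P̂_t, Z_t⟩_F/(‖P̂_t‖_F‖Z_t‖_F)`, the exact squared-norm recursion
`ρ_{t+1}² = (1−ηλ)²ρ_t² − 0.4η(1−ηλ)α_tρ_t + 0.04η²` holds; and any
nonnegative root `ρ` of the steady-state quadratic
`λρ² + 0.2αρ − 0.02η = 0` satisfies `λρ = 0.1(−α + √(α² + 2ηλ))`. -/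
theorem weight_decay_Z_steady_state {m n : ℕ} (η lam : ℝ)
    (hη : 0 < η) (hlam : 0 < lam) (hηlam1 : η * lam < 1)
    (Z Phat : ℕ → Mat m n) (hPne : ∀ t, Phat t ≠ 0) (hZne : ∀ t, Z t ≠ 0)
    (hupd : ∀ t, Z (t + 1) = Z t - (η * lam) • Z t
      - ((0.2 : ℝ) * η * Real.sqrt (m * n : ℝ) / frobNorm (Phat t)) • Phat t) :
    (∀ t : ℕ,
      (frobNorm (Z (t + 1)) / Real.sqrt (m * n : ℝ)) ^ 2 =
        (1 - η * lam) ^ 2 * (frobNorm (Z t) / Real.sqrt (m * n : ℝ)) ^ 2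
        - (0.4 : ℝ) * η * (1 - η * lam) *
            (frobInner (Phat t) (Z t) / (frobNorm (Phat t) * frobNorm (Z t))) *
            (frobNorm (Z t) / Real.sqrt (m * n : ℝ))
        + (0.04 : ℝ) * η ^ 2) ∧
    (∀ α ρ : ℝ, 0 ≤ ρ →
      lam * ρ ^ 2 + (0.2 : ℝ) * α * ρ - (0.02 : ℝ) * η = 0 →
      lam * ρ = (0.1 : ℝ) * (-α + Real.sqrt (α ^ 2 + 2 * η * lam))) := by
  constructor
  · intro t
    have hP := frobNorm_pos (hPne t)
    have hZ := frobNorm_pos (hZne t)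
    have hm : 0 < m := Nat.pos_of_ne_zero fun h => by
      subst h
      exact hZne t (Subsingleton.elim _ _)
    have hn : 0 < n := Nat.pos_of_ne_zero fun h => by
      subst h
      exact hZne t (Subsingleton.elim _ _)
    have hs : 0 < Real.sqrt (m * n : ℝ) := by positivity
    have hstep : Z (t + 1) = (1 - η * lam) • Z t
        - ((0.2 : ℝ) * η * Real.sqrt (m * n : ℝ) / frobNorm (Phat t)) • Phat t := by
      rw [hupd t, sub_smul, one_smul]
    rw [div_pow, hstep, frobNorm_smul_sub_smul_sq]
    field_simp
    ring
  · intro α ρ hρ h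
    have hx : 0 ≤ lam * ρ := by positivity
    have hpos : 0 < η * lam := by positivity
    have hq : (lam * ρ) ^ 2 + 0.2 * α * (lam * ρ) = 0.02 * (η * lam) := by
      linear_combination lam * h
    have hnn : 0 ≤ 10 * (lam * ρ) + α := by
      by_contra! hneg
      nlinarith [mul_nonneg hx (neg_nonneg.mpr hneg.le), sq_nonneg (lam * ρ)]
    have hsq : α ^ 2 + 2 * η * lam = (10 * (lam * ρ) + α) ^ 2 := by
      linear_combination -100 * hq
    rw [hsq, Real.sqrt_sq hnn]
    ring
end
end

section
/- For η > 0, λ > 0 with ηλ > 0 and β ∈ (0,1], the 2×2 matrix A = [[1 − ηλ, ηλβ], [ηλ, 1 + ηλβ]] has characteristic polynomial discriminant (ηλ)²(1 + 6β + β²), and its largest eigenvalue equals λ₁ = 1 + (ηλ/2)·(√(1 + 6β + β²) − (1 − β)), which is strictly greater than 1 for all β > 0. -/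
open Matrix MeasureTheory Finset Filter

noncomputable section

/-- The characteristic polynomial splits as soon as its discriminant is a square. -/
lemma det_sub_smul_one_eq_mul (h β s x : ℝ) (hs : s ^ 2 = 1 + 6 * β + β ^ 2) :
    Matrix.det (!![1 - h, h * β; h, 1 + h * β] - x • (1 : Matrix (Fin 2) (Fin 2) ℝ)) =
      (x - (1 + h / 2 * (s - (1 - β)))) * (x - (1 - h / 2 * (s + (1 - β)))) := by
  simp only [Matrix.det_fin_two, Matrix.sub_apply, Matrix.smul_apply, Matrix.of_apply,
    Matrix.cons_val', Matrix.cons_val_zero, Matrix.cons_val_one, Matrix.cons_val_fin_one,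
    Matrix.one_apply_eq, Matrix.one_apply_ne (zero_ne_one' (Fin 2)),
    Matrix.one_apply_ne (one_ne_zero' (Fin 2)), smul_eq_mul]
  linear_combination h ^ 2 / 4 * hs

/-- **Leading eigenvalue of the weight-decay-at-`Y` iteration matrix.**
For `A = [[1−ηλ, ηλβ], [ηλ, 1+ηλβ]]` with `ηλ > 0` and `β ∈ (0,1]`, the
characteristic-polynomial discriminant is `(ηλ)²(1+6β+β²)`, and the largest
eigenvalue is `λ₁ = 1 + (ηλ/2)(√(1+6β+β²) − (1−β)) > 1`. -/
theorem weight_decay_Y_leading_eigenvalue (η lam β : ℝ)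
    (hη : 0 < η) (hlam : 0 < lam) (hηlam : 0 < η * lam)
    (hβ0 : 0 < β) (hβ1 : β ≤ 1) :
    let A : Matrix (Fin 2) (Fin 2) ℝ :=
      !![1 - η * lam, η * lam * β; η * lam, 1 + η * lam * β]
    let lam1 : ℝ :=
      1 + (η * lam / 2) * (Real.sqrt (1 + 6 * β + β ^ 2) - (1 - β))
    (Matrix.trace A) ^ 2 - 4 * Matrix.det A = (η * lam) ^ 2 * (1 + 6 * β + β ^ 2) ∧
    Matrix.det (A - lam1 • (1 : Matrix (Fin 2) (Fin 2) ℝ)) = 0 ∧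
    (∀ x : ℝ, Matrix.det (A - x • (1 : Matrix (Fin 2) (Fin 2) ℝ)) = 0 → x ≤ lam1) ∧
    1 < lam1 := by
  intro A lam1
  have hs : Real.sqrt (1 + 6 * β + β ^ 2) ^ 2 = 1 + 6 * β + β ^ 2 :=
    Real.sq_sqrt (by positivity)
  have hlt : 1 - β < Real.sqrt (1 + 6 * β + β ^ 2) := Real.lt_sqrt_of_sq_lt (by nlinarith)
  have hdet (x : ℝ) := det_sub_smul_one_eq_mul (η * lam) β _ x hs
  refine ⟨?_, ?_, fun x hx => ?_, ?_⟩
  · simp only [A, Matrix.trace_fin_two_of, Matrix.det_fin_two_of]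
    ring
  · rw [hdet, sub_self, zero_mul]
  · rw [hdet] at hx
    rcases mul_eq_zero.mp hx with hx | hx
    · exact (sub_eq_zero.mp hx).le
    · have := mul_nonneg hηlam.le (Real.sqrt_nonneg (1 + 6 * β + β ^ 2))
      simp only [lam1]
      linarith
  · exact lt_add_of_pos_right 1 (mul_pos (half_pos hηlam) (sub_pos.mpr hlt))
end
end

section
/- Let M ∈ ℝ^{n×n} be invertible with singular value decomposition M = UΣVᵀ (U, V ∈ ℝ^{n×n} orthogonal, Σ positive diagonal). Then (MMᵀ)^{−1/4} · M · (MᵀM)^{−1/4} = UVᵀ = polar(M), where for a positive-definite symmetric matrix A, A^{−1/4} denotes its unique positive-definite real power with exponent −1/4. In other words, Shampoo's preconditioned update with collapsed second-moment buffers (β₂ = 0) coincides exactly with the polar factor of the momentum matrix. -/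
open Matrix MeasureTheory Finset Filter

noncomputable section

open scoped MatrixOrder Matrix.Norms.L2Operator in
/-- A positive semidefinite matrix is determined by its fourth power. -/
lemma Matrix.PosSemidef.eq_of_pow_four_eq {ι : Type*} [Fintype ι] [DecidableEq ι]
    {A B : Matrix ι ι ℝ} (hA : A.PosSemidef) (hB : B.PosSemidef) (h : A ^ 4 = B ^ 4) :
    A = B := by
  refine (CFC.sq_eq_sq_iff A B hA.nonneg hB.nonneg).1 ?_
  refine (CFC.sq_eq_sq_iff (A ^ 2) (B ^ 2) (hA.pow 2).nonneg (hB.pow 2).nonneg).1 ?_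
  simpa only [← pow_mul] using h

lemma Matrix.mul_diagonal_mul_transpose_mul {ι κ : Type*} [Fintype ι] [DecidableEq ι]
    [Fintype κ] {l m : Type*} {V : Matrix κ ι ℝ} (hV : Vᵀ * V = 1)
    (U : Matrix l ι ℝ) (W : Matrix m ι ℝ) (d e : ι → ℝ) :
    (U * diagonal d * Vᵀ) * (V * diagonal e * Wᵀ) = U * diagonal (d * e) * Wᵀ := by
  calc (U * diagonal d * Vᵀ) * (V * diagonal e * Wᵀ)
      = U * diagonal d * (Vᵀ * V) * diagonal e * Wᵀ := by simp only [Matrix.mul_assoc]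
    _ = U * diagonal (d * e) * Wᵀ := by
      rw [hV, Matrix.mul_one, Matrix.mul_assoc U, diagonal_mul_diagonal]
      rfl

/-- The inverse fourth root of `U Σ² Uᵀ` is `U Σ^{-1/2} Uᵀ`. -/
lemma Matrix.PosSemidef.eq_of_pow_four_mul_eq_one {ι : Type*} [Fintype ι] [DecidableEq ι]
    {A U : Matrix ι ι ℝ} {s : ι → ℝ} (hA : A.PosSemidef) (hU : Uᵀ * U = 1)
    (hs : ∀ i, 0 < s i) (h : A ^ 4 * (U * diagonal (s * s) * Uᵀ) = 1) :
    A = U * diagonal (fun i => (√(s i))⁻¹) * Uᵀ := by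
  set d : ι → ℝ := fun i => (√(s i))⁻¹ with hd
  have hD : (U * diagonal d * Uᵀ).PosSemidef := by
    have hdiag : (diagonal d).PosSemidef :=
      PosSemidef.diagonal fun i => inv_nonneg.2 (Real.sqrt_nonneg _)
    simpa using hdiag.mul_mul_conjTranspose_same U
  refine hA.eq_of_pow_four_eq hD ?_
  have hds : s * s * (d * d * (d * d)) = 1 := by
    funext i
    have h2 : d i * d i = (s i)⁻¹ := by
      rw [hd, ← mul_inv, Real.mul_self_sqrt (hs i).le]
    have h0 := (hs i).ne'
    simp only [Pi.mul_apply, Pi.one_apply, h2]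
    field_simp
  have hD4 : (U * diagonal (s * s) * Uᵀ) * (U * diagonal d * Uᵀ) ^ 4 = 1 := by
    rw [show 4 = 2 * 2 from rfl, pow_mul, pow_two, pow_two,
      mul_diagonal_mul_transpose_mul hU, mul_diagonal_mul_transpose_mul hU,
      mul_diagonal_mul_transpose_mul hU, hds]
    simpa using mul_eq_one_comm.1 hU
  exact left_inv_eq_right_inv h hD4

/-- **Shampoo with collapsed buffers is the polar factor.**
For invertible `M = UΣVᵀ` (`U, V` orthogonal, `Σ` positive diagonal), if `L` and
`R` are the unique symmetric positive-definite matrices with `L⁴ = (MMᵀ)⁻¹` and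
`R⁴ = (MᵀM)⁻¹` (i.e. `L = (MMᵀ)^{-1/4}`, `R = (MᵀM)^{-1/4}`), then
`L·M·R = UVᵀ = polar(M)`. -/
theorem shampoo_collapsed_is_polar {n : ℕ} (M U V : Matrix (Fin n) (Fin n) ℝ)
    (s : Fin n → ℝ)
    (hU : Uᵀ * U = 1) (hV : Vᵀ * V = 1) (hs : ∀ i, 0 < s i)
    (hM : M = U * Matrix.diagonal s * Vᵀ) (hMinv : IsUnit M.det)
    (L R : Matrix (Fin n) (Fin n) ℝ)
    (hLsymm : L.IsSymm) (hLpd : L.PosDef)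
    (hRsymm : R.IsSymm) (hRpd : R.PosDef)
    (hL4 : L ^ 4 * (M * Mᵀ) = 1) (hR4 : R ^ 4 * (Mᵀ * M) = 1) :
    L * M * R = U * Vᵀ := by
  have hMt : Mᵀ = V * diagonal s * Uᵀ := by
    simp [hM, Matrix.mul_assoc]
  rw [hMt, hM, mul_diagonal_mul_transpose_mul hV] at hL4
  rw [hMt, hM, mul_diagonal_mul_transpose_mul hU] at hR4
  rw [hLpd.posSemidef.eq_of_pow_four_mul_eq_one hU hs hL4,
    hRpd.posSemidef.eq_of_pow_four_mul_eq_one hV hs hR4, hM,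
    mul_diagonal_mul_transpose_mul hU, mul_diagonal_mul_transpose_mul hV]
  have hd : (fun i => (√(s i))⁻¹) * s * (fun i => (√(s i))⁻¹) = 1 := by
    funext i
    have h0 := (Real.sqrt_pos.2 (hs i)).ne'
    simp only [Pi.mul_apply, Pi.one_apply]
    field_simp
    rw [Real.sq_sqrt (hs i).le]
  simp [hd]
end
end
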